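/- arXiv:1406.5925 — 3 statements merged into one kernel-verified Lean document; each statement's English description precedes it below -/
import Mathlib

section
/- Let R be a ring (associative with identity, not necessarily commutative). Then R is uniquely weakly nil-clean if and only if: (1) R is abelian; (2) R is periodic; and (3) R/J(R) is isomorphic (as a ring) to one of the following: ℤ/3ℤ, a Boolean ring, or ℤ/3ℤ × B where B is a Boolean ring. -/
universe u v

/-- An element `e` is a very idempotent if `e` or `-e` is an idempotent. -/
def IsVeryIdempotent {R : Type u} [Ring R] (e : R) : Prop :=
  IsIdempotentElem e ∨ IsIdempotentElem (-e)

/-- `a` is uniquely weakly nil-clean: it is a sum of a nilpotent and a very idempotent,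
and for any two such representations `a = w₁ + e₁ = w₂ + e₂` one has `e₁ ^ 2 = e₂ ^ 2`. -/
def IsUniquelyWeaklyNilClean {R : Type u} [Ring R] (a : R) : Prop :=
  (∃ w e : R, IsNilpotent w ∧ IsVeryIdempotent e ∧ a = w + e) ∧
  ∀ w₁ e₁ w₂ e₂ : R, IsNilpotent w₁ → IsVeryIdempotent e₁ → IsNilpotent w₂ →
    IsVeryIdempotent e₂ → a = w₁ + e₁ → a = w₂ + e₂ → e₁ ^ 2 = e₂ ^ 2

/-- A ring is uniquely weakly nil-clean if every element is. -/
def UniquelyWeaklyNilCleanRing (R : Type u) [Ring R] : Prop :=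
  ∀ a : R, IsUniquelyWeaklyNilClean a

/-- `a` is uniquely nil-clean: it is a sum of a nilpotent and an idempotent,
and for any two such representations `a = w₁ + e₁ = w₂ + e₂` one has `e₁ = e₂`. -/
def IsUniquelyNilClean {R : Type u} [Ring R] (a : R) : Prop :=
  (∃ w e : R, IsNilpotent w ∧ IsIdempotentElem e ∧ a = w + e) ∧
  ∀ w₁ e₁ w₂ e₂ : R, IsNilpotent w₁ → IsIdempotentElem e₁ → IsNilpotent w₂ →
    IsIdempotentElem e₂ → a = w₁ + e₁ → a = w₂ + e₂ → e₁ = e₂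

/-- A ring is uniquely nil-clean if every element is. -/
def UniquelyNilCleanRing (R : Type u) [Ring R] : Prop :=
  ∀ a : R, IsUniquelyNilClean a

/-- `a` is a zero-divisor: there are nonzero `b, c` with `a * b = 0` and `c * a = 0`. -/
def IsZeroDivisorPair {R : Type u} [Ring R] (a : R) : Prop :=
  ∃ b c : R, b ≠ 0 ∧ c ≠ 0 ∧ a * b = 0 ∧ c * a = 0

/-- A ring is abelian if every idempotent is central. -/
def AbelianRing (R : Type u) [Ring R] : Prop :=
  ∀ e : R, IsIdempotentElem e → ∀ x : R, e * x = x * e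

/-- A ring is periodic if every element satisfies `a ^ m = a ^ n` for distinct positive `m, n`. -/
def PeriodicRing (R : Type u) [Ring R] : Prop :=
  ∀ a : R, ∃ m n : ℕ, 0 < m ∧ 0 < n ∧ m ≠ n ∧ a ^ m = a ^ n

/-- A Boolean ring: every element is idempotent. -/
def IsBooleanRing (R : Type u) [Ring R] : Prop :=
  ∀ a : R, IsIdempotentElem a

/-- `R / J(R)` is isomorphic to `S`, expressed via a surjective ring homomorphism
whose kernel is exactly the Jacobson radical of `R`. -/
def QuotJacobsonIsoTo (R : Type u) [Ring R] (S : Type v) [Ring S] : Prop :=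
  ∃ f : R →+* S, Function.Surjective f ∧
    ∀ a : R, f a = 0 ↔ a ∈ Ideal.jacobson (⊥ : Ideal R)


section helpers

theorem vi_cube {R : Type u} [Ring R] {e : R} (h : IsVeryIdempotent e) : e * e * e = e := by
  rcases h with h | h
  · rw [h.eq, h.eq]
  · have h1 : e * e = -e := by simpa [IsIdempotentElem] using h
    rw [h1, neg_mul, h1, neg_neg]

theorem vi_sq {R : Type u} [Ring R] {e : R} (h : IsVeryIdempotent e) :
    IsIdempotentElem (e ^ 2) := by
  have := vi_cube h
  unfold IsIdempotentElem
  rw [sq, ← mul_assoc, this]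

theorem vi_nil {R : Type u} [Ring R] {e : R} (h : IsVeryIdempotent e) (hn : IsNilpotent e) :
    e = 0 := by
  have h3 := vi_cube h
  have h2 := vi_sq h
  obtain ⟨n, hn⟩ := hn
  have : e ^ 2 = 0 := by
    rw [← h2.pow_succ_eq n, ← pow_mul, mul_comm 2, pow_mul, pow_succ e, hn]
    simp
  rw [← h3, ← sq, this, zero_mul]

theorem vi_comm {R : Type u} [Ring R] (hab : AbelianRing R) {e : R} (h : IsVeryIdempotent e)
    (x : R) : Commute e x := by
  rcases h with h | h
  · exact hab e h x
  · have : Commute (-e) x := hab _ h x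
    simpa using this.neg_left

theorem jac_cancel {R : Type u} [Ring R] {x y : R} (hx : x ∈ Ideal.jacobson (⊥ : Ideal R))
    (h : x * y = y) : y = 0 := by
  obtain ⟨s, hs⟩ := Ideal.exists_mul_add_sub_mem_of_mem_jacobson (-x) (neg_mem hx)
  have hs : s * (-x + 1) = 1 := by simpa [sub_eq_zero] using hs
  calc y = s * (-x + 1) * y := by rw [hs, one_mul]
    _ = 0 := by rw [mul_assoc, add_mul, one_mul, neg_mul, h]; simp

theorem backward {R : Type u} [Ring R] {S : Type v} [Ring S] (hab : AbelianRing R)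
    (hp : PeriodicRing R) (hS : ∀ s : S, IsVeryIdempotent s) (hq : QuotJacobsonIsoTo R S) :
    UniquelyWeaklyNilCleanRing R := by
  obtain ⟨f, hf, hk⟩ := hq
  have hJ : ∀ x : R, f x = 0 → IsNilpotent x := by
    intro x hx
    obtain ⟨m, n, hm, hn, hmn, h⟩ := hp x
    wlog hlt : m < n generalizing m n
    · exact this n m hn hm hmn.symm h.symm (by omega)
    refine ⟨m, jac_cancel (x := x ^ (n - m)) ?_ ?_⟩
    · rw [← hk, map_pow, hx, zero_pow (by omega)]
    · rw [← pow_add, h]; congr 1; omega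
  have hN : ∀ x : R, IsNilpotent x → f x = 0 := fun x hx => vi_nil (hS _) (hx.map f)
  have hlift : ∀ s : S, IsIdempotentElem s → ∃ e : R, IsIdempotentElem e ∧ f e = s := fun s hs =>
    exists_isIdempotentElem_eq_of_ker_isNilpotent f (fun x hx => hJ x hx) s (hf s) hs
  intro a
  constructor
  · rcases hS (f a) with h | h
    · obtain ⟨e, he, hfe⟩ := hlift _ h
      exact ⟨a - e, e, hJ _ (by simp [hfe]), Or.inl he, by simp⟩
    · obtain ⟨e, he, hfe⟩ := hlift _ h
      exact ⟨a + e, -e, hJ _ (by simp [hfe]), Or.inr (by simpa using he), by simp⟩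
  · intro w₁ e₁ w₂ e₂ hw₁ he₁ hw₂ he₂ h₁ h₂
    refine eq_of_isNilpotent_sub_of_isIdempotentElem_of_commute (vi_sq he₁) (vi_sq he₂)
      (hJ _ ?_) (hab _ (vi_sq he₁) _)
    have : f e₁ = f e₂ := by
      have h := congrArg f (h₁.symm.trans h₂)
      simpa [hN _ hw₁, hN _ hw₂] using h
    simp [this]

theorem fwd_abelian {R : Type u} [Ring R] (h : UniquelyWeaklyNilCleanRing R) : AbelianRing R := by
  intro e he x
  have he' : e * e = e := he
  have key : ∀ r : R, r * r = 0 → e * r + r * e = r → r = 0 := by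
    intro r hr h1
    have hid : IsIdempotentElem (e + r) := by
      unfold IsIdempotentElem
      calc (e + r) * (e + r) = e * e + (e * r + r * e) + r * r := by noncomm_ring
        _ = e + r := by rw [hr, h1, he', add_zero]
    have := (h (e + r)).2 r e 0 (e + r) ⟨2, by rw [sq, hr]⟩ (Or.inl he) IsNilpotent.zero
      (Or.inl hid) (add_comm _ _) (by simp)
    rw [sq, sq, he', hid.eq] at this
    simpa using this
  have e1 : e * x - e * x * e = 0 := by
    apply key
    · have : (e * x - e * x * e) * (e * x - e * x * e)
        = e * x * e * x - e * x * e * x * e - e * x * (e * e) * x + e * x * (e * e) * x * e := by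
        noncomm_ring
      rw [this, he']; noncomm_ring
    · have : e * (e * x - e * x * e) + (e * x - e * x * e) * e
        = (e * e) * x - (e * e) * x * e + e * x * e - e * x * (e * e) := by noncomm_ring
      rw [this, he']; noncomm_ring
  have e2 : x * e - e * x * e = 0 := by
    apply key
    · have : (x * e - e * x * e) * (x * e - e * x * e)
        = x * e * x * e - x * (e * e) * x * e - e * x * e * x * e + e * x * (e * e) * x * e := by
        noncomm_ring
      rw [this, he']; noncomm_ring
    · have : e * (x * e - e * x * e) + (x * e - e * x * e) * e
        = e * x * e - (e * e) * x * e + x * (e * e) - e * x * (e * e) := by noncomm_ring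
      rw [this, he']; noncomm_ring
  rw [sub_eq_zero.mp e1, sub_eq_zero.mp e2]

theorem fwd_six {R : Type u} [Ring R] (hab : AbelianRing R) (h : UniquelyWeaklyNilCleanRing R) :
    IsNilpotent (6 : R) := by
  obtain ⟨w, e, hw, he, h2⟩ := (h 2).1
  have hc := vi_comm hab he
  have hwe : w = 2 - e := by rw [h2]; simp
  have h6 : ∃ t : R, (6 : R) = w * t ∧ Commute w t := by
    rcases he with he | he
    · have he : e * e = e := he
      refine ⟨3 + 3 * e, ?_, ?_⟩
      · rw [hwe]
        have : (2 - e) * (3 + 3 * e) = 6 + 3 * e - 3 * (e * e) := by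
          rw [show (6 : R) = 3 * 2 by norm_num]; noncomm_ring
        rw [this, he]; simp
      · exact (Commute.ofNat_right _ _).add_right
          ((Commute.ofNat_right _ _).mul_right (hc w).symm)
    · have he : e * e = -e := by simpa [IsIdempotentElem] using he
      refine ⟨3 + e, ?_, ?_⟩
      · rw [hwe]
        have : (2 - e) * (3 + e) = 6 - e - e * e := by
          rw [show (6 : R) = 3 * 2 by norm_num]; noncomm_ring
        rw [this, he]; simp
      · exact (Commute.ofNat_right _ _).add_right (hc w).symm
  obtain ⟨t, h6, ht⟩ := h6
  rw [h6]
  exact ht.isNilpotent_mul_right hw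

open Polynomial in
theorem fwd_periodic {R : Type u} [Ring R] (hab : AbelianRing R)
    (h : UniquelyWeaklyNilCleanRing R) : PeriodicRing R := by
  intro a
  obtain ⟨k, hk⟩ := fwd_six hab h
  have hcast : ((6 ^ k : ℕ) : R) = 0 := by push_cast; exact hk
  have hdvd : ringChar R ∣ 6 ^ k := ringChar.dvd hcast
  have hne : NeZero (ringChar R) := ⟨fun h0 => by rw [h0] at hdvd; simp at hdvd⟩
  letI : Algebra (ZMod (ringChar R)) R := ZMod.algebra R (ringChar R)
  have hnil : IsNilpotent (a ^ 3 - a) := by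
    obtain ⟨w, e, hw, he, h2⟩ := (h a).1
    have hc := (vi_comm hab he w)
    have hc' : e * w = w * e := hc
    have h3 := vi_cube he
    have : a ^ 3 - a = w * (w * w + 3 * (e * w) + 3 * (e * e) - 1) := by
      have e1 : a ^ 3 - a = w * w * w + (w * w * e + w * (e * w) + (e * w) * w)
        + (w * e * e + (e * w) * e + e * (e * w)) + (e * e * e) - (w + e) := by
        rw [h2]; noncomm_ring
      rw [e1, h3]
      simp only [hc']
      have e2 : e * (w * e) = w * (e * e) := by rw [← mul_assoc, hc', mul_assoc]
      have e3 : w * e * w = w * (w * e) := by rw [mul_assoc, hc']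
      rw [e2, e3]
      noncomm_ring
    rw [this]
    refine Commute.isNilpotent_mul_right ?_ hw
    have c1 : Commute w w := Commute.refl w
    exact ((((c1.mul_right c1).add_right ((Commute.ofNat_right _ _).mul_right
      (hc.symm.mul_right c1))).add_right ((Commute.ofNat_right _ _).mul_right
      (hc.symm.mul_right hc.symm))).sub_right (Commute.one_right _))
  obtain ⟨n, hn⟩ := hnil
  have hint : IsIntegral (ZMod (ringChar R)) a := by
    refine ⟨(X ^ 3 - X) ^ n, ?_, ?_⟩
    · apply Monic.pow
      nontriviality (ZMod (ringChar R))
      apply monic_X_pow_sub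
      rw [degree_X]; norm_num
    · have : aeval a ((X ^ 3 - X : (ZMod (ringChar R))[X]) ^ n) = 0 := by simp [hn]
      exact this
  have hfg := hint.fg_adjoin_singleton
  have hfin : Module.Finite (ZMod (ringChar R))
    (Subalgebra.toSubmodule (Algebra.adjoin (ZMod (ringChar R)) {a})) := Module.Finite.iff_fg.mpr hfg
  have hF : Finite (Subalgebra.toSubmodule (Algebra.adjoin (ZMod (ringChar R)) {a})) :=
    Module.finite_of_finite (ZMod (ringChar R))
  let g : ℕ → (Subalgebra.toSubmodule (Algebra.adjoin (ZMod (ringChar R)) {a})) := fun n =>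
    ⟨a ^ (n + 1), Subalgebra.pow_mem _ (Algebra.self_mem_adjoin_singleton _ a) _⟩
  obtain ⟨i, j, hij, hg⟩ := Finite.exists_ne_map_eq_of_infinite g
  exact ⟨i + 1, j + 1, by omega, by omega, by omega, congrArg Subtype.val hg⟩

theorem fwd_nil_jac {R : Type u} [Ring R] (hab : AbelianRing R)
    (h : UniquelyWeaklyNilCleanRing R) {a : R} (ha : IsNilpotent a) :
    a ∈ Ideal.jacobson (⊥ : Ideal R) := by
  obtain ⟨n, hn⟩ := ha
  have key : ∀ y : R, IsNilpotent (y * a) := by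
    intro y
    obtain ⟨w, e, hw, he, h2⟩ := (h (y * a)).1
    have hc := vi_comm hab he
    have h3 := vi_cube he
    have hc2 : ∀ x, Commute (e * e) x := fun x => (hc x).mul_left (hc x)
    obtain ⟨u, hu⟩ := ((hc w).isNilpotent_mul_left hw).isUnit_one_add
    set t := (↑u⁻¹ : R) * (e * y) with ht
    have h1 : t * a * (e * e) = e * e := by
      calc t * a * (e * e) = (↑u⁻¹ : R) * (e * (y * a) * (e * e)) := by rw [ht]; noncomm_ring
        _ = (↑u⁻¹ : R) * (e * (e * e) * w + (e * e * e) * e) := by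
            rw [h2, mul_assoc e, add_mul, ← (hc2 w).eq]; noncomm_ring
        _ = (↑u⁻¹ : R) * ((1 + e * w) * (e * e)) := by
            rw [← mul_assoc e e e, h3, add_mul, one_mul, mul_assoc e w, ← (hc2 w).eq,
              ← mul_assoc e (e * e), ← mul_assoc e e e, h3, add_comm]
        _ = e * e := by rw [← hu, ← mul_assoc, Units.inv_mul, one_mul]
    have hpow : ∀ k : ℕ, t ^ k * a ^ k * (e * e) = e * e := by
      intro k
      induction k with
      | zero => simp
      | succ k ih =>
        calc t ^ (k + 1) * a ^ (k + 1) * (e * e)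
            = t * (t ^ k * a ^ k) * (a * (e * e)) := by
              rw [pow_succ' t, pow_succ a]; noncomm_ring
          _ = t * (t ^ k * a ^ k * (e * e)) * a := by
              rw [← (hc2 a).eq]; noncomm_ring
          _ = e * e := by rw [ih, mul_assoc, (hc2 a).eq, ← mul_assoc, h1]
    have hee : e * e = 0 := by rw [← hpow n, hn]; simp
    have he0 : e = 0 := by rw [← h3, hee, zero_mul]
    rw [h2, he0, add_zero]
    exact hw
  rw [Ideal.mem_jacobson_iff]
  intro y
  obtain ⟨u, hu⟩ := (key y).isUnit_one_add
  refine ⟨(↑u⁻¹ : R), ?_⟩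
  have : (↑u⁻¹ : R) * y * a + ↑u⁻¹ - 1 = ↑u⁻¹ * (1 + y * a) - 1 := by noncomm_ring
  rw [this, ← hu, Units.inv_mul, sub_self]
  exact Submodule.zero_mem _

theorem split {S : Type u} [CommRing S] (hS : ∀ s : S, IsVeryIdempotent s) :
    IsBooleanRing S ∨ ∃ (B : Type u) (_ : Ring B), IsBooleanRing B ∧
      ∃ g : S →+* ZMod 3 × B, Function.Bijective g := by
  have hcube : ∀ s : S, s * s * s = s := fun s => vi_cube (hS s)
  have h6 : (6 : S) = 0 := by linear_combination hcube 2
  -- `e = 4` is idempotent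
  by_cases h2 : (2 : S) = 0
  · left
    intro a
    rcases hS a with h | h
    · exact h
    · have : a * a = -a := by simpa [IsIdempotentElem] using h
      change a * a = a
      linear_combination this - a * h2
  right
  let I : Ideal S := Ideal.span {(4 : S)}
  let K : Ideal S := Ideal.span {(3 : S)}
  have memI : ∀ x : S, x ∈ I → 3 * x = 0 := by
    intro x hx
    obtain ⟨c, rfl⟩ := Ideal.mem_span_singleton.mp hx
    linear_combination 2 * c * h6
  have memK : ∀ x : S, x ∈ K → 4 * x = 0 := by
    intro x hx
    obtain ⟨c, rfl⟩ := Ideal.mem_span_singleton.mp hx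
    linear_combination 2 * c * h6
  have hB : IsBooleanRing (S ⧸ I) := by
    intro b
    obtain ⟨a, rfl⟩ := Ideal.Quotient.mk_surjective b
    change Ideal.Quotient.mk I a * Ideal.Quotient.mk I a = Ideal.Quotient.mk I a
    rw [← map_mul, Ideal.Quotient.eq, Ideal.mem_span_singleton]
    rcases hS a with h | h
    · have h : a * a = a := h
      exact ⟨0, by linear_combination h⟩
    · have h : a * a = -a := by simpa [IsIdempotentElem] using h
      exact ⟨a, by linear_combination h - a * h6⟩
  have hnt : Nontrivial (S ⧸ K) := by
    rw [Ideal.Quotient.nontrivial_iff]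
    intro ht
    have := memK 1 (by rw [ht]; trivial)
    exact h2 (by linear_combination h6 - this)
  have h3K : ((3 : ℕ) : S ⧸ K) = 0 := by
    have : Ideal.Quotient.mk K (3 : S) = 0 :=
      Ideal.Quotient.eq_zero_iff_mem.mpr (Ideal.mem_span_singleton_self _)
    rw [← this, ← map_natCast (Ideal.Quotient.mk K)]; norm_num
  have hch : CharP (S ⧸ K) 3 := (CharP.charP_iff_prime_eq_zero Nat.prime_three).mpr h3K
  have hidem : ∀ g : S, g * g = g → Ideal.Quotient.mk K g = 0 ∨ Ideal.Quotient.mk K g = 1 := by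
    intro g hg
    have hsq : (2 * g - 1) * (2 * g - 1) = 1 := by linear_combination 4 * hg
    rcases hS (2 * g - 1) with h | h
    · right
      have h : (2 * g - 1) * (2 * g - 1) = 2 * g - 1 := h
      have : g - 1 ∈ K := by
        rw [Ideal.mem_span_singleton]
        exact ⟨g - 1, by linear_combination h - hsq⟩
      simpa using (Ideal.Quotient.eq (I := K)).mpr this
    · left
      have h : (2 * g - 1) * (2 * g - 1) = -(2 * g - 1) := by
        have h' : (-(2 * g - 1)) * (-(2 * g - 1)) = -(2 * g - 1) := h
        rwa [neg_mul_neg] at h'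
      rw [Ideal.Quotient.eq_zero_iff_mem, Ideal.mem_span_singleton]
      exact ⟨g, by linear_combination hsq - h⟩
  have hbij : Function.Bijective (ZMod.castHom (dvd_refl 3) (S ⧸ K)) := by
    refine ⟨ZMod.castHom_injective _, ?_⟩
    intro b
    obtain ⟨a, rfl⟩ := Ideal.Quotient.mk_surjective b
    rcases hS a with h | h
    · rcases hidem a h with h | h
      · exact ⟨0, by rw [h, map_zero]⟩
      · exact ⟨1, by rw [h, map_one]⟩
    · rcases hidem (-a) h with h | h
      · exact ⟨0, by rw [map_neg, neg_eq_zero] at h; rw [h, map_zero]⟩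
      · exact ⟨-1, by rw [map_neg] at h; rw [map_neg, map_one, ← h, neg_neg]⟩
  let φ : ZMod 3 ≃+* S ⧸ K := RingEquiv.ofBijective _ hbij
  refine ⟨S ⧸ I, inferInstance, hB,
    (φ.symm.toRingHom.comp (Ideal.Quotient.mk K)).prod (Ideal.Quotient.mk I), ?_, ?_⟩
  · rw [injective_iff_map_eq_zero]
    intro a ha
    have h1 : φ.symm (Ideal.Quotient.mk K a) = 0 := congrArg Prod.fst ha
    have h2 : Ideal.Quotient.mk I a = 0 := congrArg Prod.snd ha
    have h1 : Ideal.Quotient.mk K a = 0 := by simpa using h1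
    have h1 := memK _ (Ideal.Quotient.eq_zero_iff_mem.mp h1)
    have h2 := memI _ (Ideal.Quotient.eq_zero_iff_mem.mp h2)
    linear_combination h1 - h2
  · rintro ⟨x, y⟩
    obtain ⟨b, hb⟩ := Ideal.Quotient.mk_surjective (φ x)
    obtain ⟨c, rfl⟩ := Ideal.Quotient.mk_surjective y
    refine ⟨4 * b - 3 * c, Prod.ext ?_ ?_⟩
    · change φ.symm (Ideal.Quotient.mk K (4 * b - 3 * c)) = x
      rw [RingEquiv.symm_apply_eq, ← hb, Ideal.Quotient.eq, Ideal.mem_span_singleton]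
      exact ⟨b - c, by ring⟩
    · change Ideal.Quotient.mk I (4 * b - 3 * c) = Ideal.Quotient.mk I c
      rw [Ideal.Quotient.eq, Ideal.mem_span_singleton]
      exact ⟨b - c, by ring⟩

theorem boolean_vi {B : Type u} [Ring B] (hB : IsBooleanRing B) (x : ZMod 3 × B) :
    IsVeryIdempotent x := by
  obtain ⟨x, b⟩ := x
  have h3 : ∀ x : ZMod 3, x * x = x ∨ (-x) * (-x) = -x := by decide
  rcases h3 x with h | h
  · exact Or.inl (Prod.ext h (hB b))
  · exact Or.inr (Prod.ext h (hB (-b)))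

end helpers

theorem stmt0 (R : Type u) [Ring R] :
    UniquelyWeaklyNilCleanRing R ↔
      AbelianRing R ∧ PeriodicRing R ∧
        (QuotJacobsonIsoTo R (ZMod 3) ∨
          (∃ (B : Type u) (_ : Ring B), IsBooleanRing B ∧ QuotJacobsonIsoTo R B) ∨
          (∃ (B : Type u) (_ : Ring B), IsBooleanRing B ∧ QuotJacobsonIsoTo R (ZMod 3 × B))) := by
  constructor
  · intro h
    have hab := fwd_abelian h
    refine ⟨hab, fwd_periodic hab h, Or.inr ?_⟩
    let J : Ideal R := Ideal.jacobson ⊥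
    let π : R →+* R ⧸ J := Ideal.Quotient.mk J
    have hπ : Function.Surjective π := Ideal.Quotient.mk_surjective
    have hker : ∀ a, π a = 0 ↔ a ∈ Ideal.jacobson (⊥ : Ideal R) := fun a =>
      Ideal.Quotient.eq_zero_iff_mem
    have hrep : ∀ s : R ⧸ J, ∃ e : R, IsVeryIdempotent e ∧ π e = s := by
      intro s
      obtain ⟨a, rfl⟩ := hπ s
      obtain ⟨w, e, hw, he, h2⟩ := (h a).1
      refine ⟨e, he, ?_⟩
      rw [h2, map_add, (hker w).mpr (fwd_nil_jac hab h hw), zero_add]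
    letI : CommRing (R ⧸ J) :=
      { (inferInstance : Ring (R ⧸ J)) with
        mul_comm := by
          intro x y
          obtain ⟨e, he, rfl⟩ := hrep x
          obtain ⟨b, rfl⟩ := hπ y
          rw [← map_mul, ← map_mul, (vi_comm hab he b).eq] }
    have hS : ∀ s : R ⧸ J, IsVeryIdempotent s := by
      intro s
      obtain ⟨e, he, rfl⟩ := hrep s
      rcases he with he | he
      · exact Or.inl (he.map π)
      · exact Or.inr (by rw [← map_neg]; exact he.map π)
    rcases split hS with hB | ⟨B, hRB, hB, g, hg⟩
    · exact Or.inl ⟨R ⧸ J, inferInstance, hB, π, hπ, hker⟩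
    · refine Or.inr ⟨B, hRB, hB, g.comp π, hg.2.comp hπ, fun a => ?_⟩
      rw [← hker, RingHom.comp_apply, map_eq_zero_iff g hg.1]
  · rintro ⟨hab, hp, hq | ⟨B, hRB, hB, hq⟩ | ⟨B, hRB, hB, hq⟩⟩
    · refine backward hab hp ?_ hq
      unfold IsVeryIdempotent IsIdempotentElem
      decide
    · exact backward hab hp (fun s => Or.inl (hB s)) hq
    · exact backward hab hp (boolean_vi hB) hq
end

section
/- Let p be a prime number, let R be a ring (associative with identity, not necessarily commutative) with p·1 ∈ J(R), and let G be a locally finite p-group (every element of G has order a power of p and every finitely generated subgroup of G is finite). Then the group ring RG is uniquely weakly nil-clean if and only if R is uniquely weakly nil-clean. -/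
universe u v

/-- The augmentation map. -/
noncomputable def augm (R : Type u) [Ring R] (G : Type v) [Group G] : MonoidAlgebra R G →+* R :=
  MonoidAlgebra.liftNCRingHom (RingHom.id R) (1 : G →* R) (fun _ _ => Commute.one_right _)

theorem augm_single {R : Type u} [Ring R] {G : Type v} [Group G] (g : G) (r : R) :
    augm R G (MonoidAlgebra.single g r) = r := by
  simp [augm]

theorem augm_mapDomain {R : Type u} [Ring R] {G : Type v} {H : Type v} [Group G] [Group H]
    (f : G →* H) (x : MonoidAlgebra R G) :
    augm R H (MonoidAlgebra.mapDomainRingHom R f x) = augm R G x := by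
  induction x using MonoidAlgebra.induction_linear with
  | zero => simp
  | add x y hx hy => simp [map_add] at *; rw [hx, hy]
  | single g r => simp [augm_single]

theorem nilp_of_sub_one {p : ℕ} (hp : p.Prime) {A : Type*} [Ring A] (hpA : IsNilpotent (p : A))
    (z : A) (n : ℕ) (hz : z ^ p ^ n = 1) : IsNilpotent (z - 1) := by
  obtain ⟨r, hr⟩ := (Commute.one_right (z - 1)).exists_add_pow_prime_pow_eq hp n
  rw [sub_add_cancel, hz, one_pow] at hr
  simp only [mul_one, mul_assoc] at hr
  have h2 : (z - 1) ^ p ^ n = (p : A) * (-((z - 1) * r)) := by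
    rw [mul_neg, eq_neg_iff_add_eq_zero]
    have h3 : (z - 1) ^ p ^ n + (p : A) * ((z - 1) * r)
        = (z - 1) ^ p ^ n + 1 + (p : A) * ((z - 1) * r) - 1 := by abel
    rw [h3, ← hr, sub_self]
  have h4 : IsNilpotent ((z - 1) ^ p ^ n) := by
    rw [h2]
    exact (Nat.cast_commute p (-((z - 1) * r))).isNilpotent_mul_right hpA
  obtain ⟨m, hm⟩ := h4
  exact ⟨p ^ n * m, by rw [pow_mul, hm]⟩

theorem ker_mem {R : Type u} [Ring R] {H : Type v} [Group H] (z : H) (hfin : IsOfFinOrder z)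
    [hN : (Subgroup.zpowers z).Normal]
    (x : MonoidAlgebra R H)
    (hx : MonoidAlgebra.mapDomain (QuotientGroup.mk' (Subgroup.zpowers z)) x = 0) :
    x ∈ Ideal.span {MonoidAlgebra.single z (1 : R) - 1} := by
  set I : Ideal (MonoidAlgebra R H) := Ideal.span {MonoidAlgebra.single z (1 : R) - 1}
  set q := QuotientGroup.mk' (Subgroup.zpowers z)
  have key : ∀ y : MonoidAlgebra R H,
      y - MonoidAlgebra.mapDomain (Quotient.out : (H ⧸ Subgroup.zpowers z) → H)
        (MonoidAlgebra.mapDomain q y) ∈ I := by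
    intro y
    induction y using MonoidAlgebra.induction_linear with
    | zero => simp
    | add x y hx hy =>
      simp only [MonoidAlgebra.mapDomain_add]
      rw [add_sub_add_comm]
      exact I.add_mem hx hy
    | single g r =>
      simp only [MonoidAlgebra.mapDomain_single]
      obtain ⟨w, hw⟩ := QuotientGroup.mk_out_eq_mul (Subgroup.zpowers z) g
      have hq : Quotient.out (q g) = g * w := hw
      rw [hq]
      obtain ⟨k, hk⟩ := (hfin.mem_powers_iff_mem_zpowers.mpr w.2)
      have hk' : (w : H) = z ^ k := hk.symm
      have e1 : MonoidAlgebra.single g r - MonoidAlgebra.single (g * (w : H)) r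
          = -(MonoidAlgebra.single g r * (MonoidAlgebra.single z (1 : R) ^ k - 1)) := by
        rw [hk', mul_sub, MonoidAlgebra.single_pow, MonoidAlgebra.single_mul_single]
        simp
      rw [e1]
      refine I.neg_mem (I.mul_mem_left _ ?_)
      have := (Commute.one_right (MonoidAlgebra.single z (1 : R))).mul_geom_sum₂ k
      have h2 := geom_sum_mul (MonoidAlgebra.single z (1 : R)) k
      rw [← h2]
      exact I.mul_mem_left _ (Ideal.subset_span rfl)
  have := key x
  rw [hx] at this
  simpa using this

theorem augm_nil_finite {p : ℕ} (hp : p.Prime) {R : Type u} [Ring R] (hpR : IsNilpotent (p : R))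
    (n : ℕ) : ∀ (H : Type v) [Group H] [Finite H], IsPGroup p H → Nat.card H = n →
    ∀ x : MonoidAlgebra R H, augm R H x = 0 → IsNilpotent x := by
  induction n using Nat.strong_induction_on with
  | _ n ih =>
  intro H _ _ hH hcard x hx
  haveI : Fact p.Prime := ⟨hp⟩
  rcases subsingleton_or_nontrivial H with hs | hnt
  · have : x = MonoidAlgebra.single 1 (augm R H x) := by
      clear hx
      induction x using MonoidAlgebra.induction_linear with
      | zero => simp
      | add x y hx hy => rw [map_add, MonoidAlgebra.single_add, ← hx, ← hy]
      | single g r => rw [augm_single, Subsingleton.elim g 1]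
    rw [this, hx]
    simp
  · have hc := hH.center_nontrivial
    obtain ⟨⟨z, hzc⟩, hz1⟩ := exists_ne (1 : Subgroup.center H)
    have hz1 : z ≠ 1 := fun h => hz1 (Subtype.ext h)
    have hcomm : ∀ h : H, Commute z h := fun h => (Subgroup.mem_center_iff.mp hzc h).symm
    haveI hN : (Subgroup.zpowers z).Normal :=
      ⟨by
        intro a ha g
        obtain ⟨k, rfl⟩ := Subgroup.mem_zpowers_iff.mp ha
        have : g * z ^ k * g⁻¹ = z ^ k := by
          rw [← ((hcomm g).zpow_left k).eq]; group
        rw [this]; exact ha⟩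
    have hlt : Nat.card (H ⧸ Subgroup.zpowers z) < n := by
      rw [← hcard, Subgroup.card_eq_card_quotient_mul_card_subgroup (Subgroup.zpowers z)]
      have h1 : 0 < Nat.card (H ⧸ Subgroup.zpowers z) := Nat.card_pos
      have h2 : 1 < Nat.card (Subgroup.zpowers z) := by
        rw [Subgroup.one_lt_card_iff_ne_bot]
        simpa [Subgroup.zpowers_eq_bot] using hz1
      nlinarith
    have h3 := ih _ hlt (H ⧸ Subgroup.zpowers z) (hH.to_quotient _) rfl
      (MonoidAlgebra.mapDomainRingHom R (QuotientGroup.mk' (Subgroup.zpowers z)) x)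
      (by rw [augm_mapDomain, hx])
    obtain ⟨m, hm⟩ := h3
    rw [← map_pow] at hm
    have h4 := ker_mem z (isOfFinOrder_of_finite z) (x ^ m) hm
    obtain ⟨y, hy⟩ := Ideal.mem_span_singleton'.mp h4
    obtain ⟨k, hk⟩ := hH z
    have hnil : IsNilpotent (MonoidAlgebra.single z (1 : R) - 1) := by
      refine nilp_of_sub_one hp ?_ _ k ?_
      · have := hpR.map (MonoidAlgebra.singleOneRingHom : R →+* MonoidAlgebra R H)
        simpa using this
      · rw [MonoidAlgebra.single_pow, hk, one_pow]; rfl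
    have hcz : Commute y (MonoidAlgebra.single z (1 : R) - 1) :=
      ((MonoidAlgebra.single_commute hcomm (fun r => Commute.one_left r) y).symm).sub_right
        (Commute.one_right y)
    have : IsNilpotent (x ^ m) := by
      rw [← hy]; exact hcz.isNilpotent_mul_left hnil
    obtain ⟨l, hl⟩ := this
    exact ⟨m * l, by rw [pow_mul, hl]⟩

theorem augm_nil {p : ℕ} (hp : p.Prime) {R : Type u} [Ring R] (hpR : IsNilpotent (p : R))
    {G : Type v} [Group G]
    (horder : ∀ g : G, ∃ n : ℕ, orderOf g = p ^ n)
    (hlf : ∀ H : Subgroup G, H.FG → Finite H)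
    (x : MonoidAlgebra R G) (hx : augm R G x = 0) : IsNilpotent x := by
  have hG : IsPGroup p G := fun g => by
    obtain ⟨n, hn⟩ := horder g
    exact ⟨n, by rw [← hn, pow_orderOf_eq_one]⟩
  set H := Subgroup.closure (x.coeff.support : Set G)
  haveI : Finite H := hlf H ⟨x.coeff.support, rfl⟩
  have hsub : (x.coeff.support : Set G) ⊆ Set.range H.subtype := by
    intro g hg
    exact ⟨⟨g, Subgroup.subset_closure hg⟩, rfl⟩
  have hx' := MonoidAlgebra.mapDomain_comapDomain hsub H.subtype_injective
  set y := MonoidAlgebra.comapDomain H.subtype H.subtype_injective x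
  have hy : MonoidAlgebra.mapDomainRingHom R H.subtype y = x := hx'
  have h1 : IsNilpotent y := by
    refine augm_nil_finite hp hpR _ H (hG.to_subgroup H) rfl y ?_
    rw [← augm_mapDomain H.subtype, hy, hx]
  rw [← hy]
  exact h1.map _

theorem idem_nilp_eq_zero {A : Type*} [Ring A] {e f : A} (he : IsIdempotentElem e)
    (hf : IsIdempotentElem f) (hc : Commute e f) (h : IsNilpotent (e - f)) : e = f := by
  have h3 : (e - f) * ((e - f) * (e - f)) = e - f := by
    have he' : e * e = e := he
    have hf' : f * f = f := hf
    have hc' : f * e = e * f := hc.eq.symm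
    have h1 : e * (e * f) = e * f := by rw [← mul_assoc, he']
    have h2 : f * (e * f) = e * f := by rw [← mul_assoc, hc', mul_assoc, hf']
    simp only [mul_sub, sub_mul, he', hf', hc', h1, h2]
    abel
  obtain ⟨n, hn⟩ := h
  have h4 : ∀ k : ℕ, (e - f) ^ (2 * k + 1) = e - f := by
    intro k
    induction k with
    | zero => simp
    | succ k ih =>
      rw [show 2 * (k + 1) + 1 = 2 * k + 1 + 1 + 1 by ring, pow_succ, pow_succ, ih, mul_assoc, h3]
  have h5 := h4 n
  rw [show 2 * n + 1 = n + (n + 1) by ring, pow_add, hn, zero_mul] at h5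
  exact sub_eq_zero.mp h5.symm

theorem sq_idem {A : Type*} [Ring A] {e : A} (he : IsVeryIdempotent e) :
    IsIdempotentElem (e ^ 2) := by
  rcases he with h | h
  · rw [pow_two, h.eq]; exact h
  · have : e ^ 2 = -e := by rw [← h.eq]; simp [pow_two]
    rw [this]; exact h

theorem VI_map {A B : Type*} [Ring A] [Ring B] (f : A →+* B) {e : A} (he : IsVeryIdempotent e) :
    IsVeryIdempotent (f e) := by
  rcases he with h | h
  · exact Or.inl (h.map f)
  · right; rw [← map_neg]; exact h.map f

theorem nilp_nat {A : Type*} [Ring A] (hA : UniquelyWeaklyNilCleanRing A) {p : ℕ}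
    (hpJ : (p : A) ∈ Ideal.jacobson (⊥ : Ideal A)) : IsNilpotent (p : A) := by
  obtain ⟨⟨w, e, hw, he, hwe⟩, -⟩ := hA (p : A)
  suffices h : e = 0 by rw [hwe, h, add_zero]; exact hw
  have hJ := Ideal.mem_jacobson_iff.mp hpJ
  -- left inverse
  have aux : ∀ (u : A) (f v : A) (n : ℕ), v * u = 1 → f * f = f → Commute f u →
      (f * u) ^ n = 0 → f = 0 := by
    intro u f v n hv hf hc h
    have h1 : ∀ n : ℕ, f * (f * u) ^ n = f * u ^ n := by
      intro n
      induction n with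
      | zero => simp
      | succ n ih =>
        rw [pow_succ, ← mul_assoc, ih, pow_succ, mul_assoc, ← mul_assoc (u ^ n),
          ← (hc.pow_right n).eq, mul_assoc, ← mul_assoc, hf]
    have h2 : f * u ^ n = 0 := by rw [← h1, h, mul_zero]
    have h3 : v ^ n * u ^ n = 1 := by
      clear h h2
      induction n with
      | zero => simp
      | succ n ih => rw [pow_succ, pow_succ', mul_assoc, ← mul_assoc v, hv, one_mul, ih]
    calc f = (v ^ n * u ^ n) * f := by rw [h3, one_mul]
      _ = v ^ n * (f * u ^ n) := by rw [mul_assoc, (hc.pow_right n).eq]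
      _ = 0 := by rw [h2, mul_zero]
  obtain ⟨n, hn⟩ := hw
  have hw' : w = p - e := by rw [hwe]; abel
  rcases he with he | he
  · obtain ⟨v, hv⟩ := hJ (-1)
    rw [Ideal.mem_bot] at hv
    have hcw : Commute e w := by
      rw [hw']; exact (Nat.cast_commute p e).symm.sub_right (Commute.refl e)
    refine aux ((p : A) - 1) e (-v) n ?_ he
      ((Nat.cast_commute p e).symm.sub_right (Commute.one_right e)) ?_
    · rw [← sub_eq_zero, ← hv]; noncomm_ring
    · have : e * ((p : A) - 1) = e * w := by rw [hw', mul_sub, mul_sub, he.eq, mul_one]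
      rw [this, hcw.mul_pow, hn, mul_zero]
  · obtain ⟨v, hv⟩ := hJ 1
    rw [Ideal.mem_bot] at hv
    have hcw : Commute (-e) w := by
      rw [hw']
      exact (Nat.cast_commute p (-e)).symm.sub_right (Commute.refl e).neg_left
    rw [← neg_eq_zero]
    refine aux ((p : A) + 1) (-e) v n ?_ he
      ((Nat.cast_commute p (-e)).symm.add_right (Commute.one_right (-e))) ?_
    · rw [← sub_eq_zero, ← hv]; noncomm_ring
    · have : (-e) * ((p : A) + 1) = (-e) * w := by
        rw [hw', sub_eq_add_neg, mul_add, mul_add, he.eq, mul_one]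
      rw [this, hcw.mul_pow, hn, mul_zero]

theorem abel_of {A : Type*} [Ring A] (hA : UniquelyWeaklyNilCleanRing A) :
    ∀ e : A, IsIdempotentElem e → ∀ x : A, Commute e x := by
  have main : ∀ e f : A, e * e = e → f = 1 - e → ∀ n : A, n * n = 0 → e * n + n * e = n → n = 0 := by
    intro e f he hf n hn hen
    have hid : IsIdempotentElem (e + n) := by
      change (e + n) * (e + n) = e + n
      calc (e + n) * (e + n) = e * e + (e * n + n * e) + n * n := by noncomm_ring
        _ = e + n := by rw [he, hen, hn, add_zero]
    have := (hA (e + n)).2 0 (e + n) n e IsNilpotent.zero (Or.inl hid) ⟨2, by rw [pow_two, hn]⟩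
      (Or.inl he) (by simp) (add_comm _ _)
    rw [pow_two, pow_two, hid.eq, he] at this
    simpa using this
  intro e he x
  have he' : e * e = e := he
  have hz : e * (1 - e) = 0 := by rw [mul_sub, he', mul_one, sub_self]
  have hz' : (1 - e) * e = 0 := by rw [sub_mul, he', one_mul, sub_self]
  have h1 : e * x * (1 - e) = 0 := by
    refine main e _ he' rfl _ ?_ ?_
    · rw [show e * x * (1 - e) * (e * x * (1 - e)) = e * x * ((1 - e) * e) * x * (1 - e) by
        simp only [mul_assoc], hz']; simp
    · rw [show e * (e * x * (1 - e)) + e * x * (1 - e) * e = (e * e) * x * (1 - e)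
        + e * x * ((1 - e) * e) by simp only [mul_assoc], hz', he']; simp
  have h2 : (1 - e) * x * e = 0 := by
    refine main e _ he' rfl _ ?_ ?_
    · rw [show (1 - e) * x * e * ((1 - e) * x * e) = (1 - e) * x * (e * (1 - e)) * x * e by
        simp only [mul_assoc], hz]; simp
    · rw [show e * ((1 - e) * x * e) + (1 - e) * x * e * e = (e * (1 - e)) * x * e
        + (1 - e) * x * (e * e) by simp only [mul_assoc], hz, he']; simp
  have h3 : e * x = e * x * e := by
    rw [mul_sub, mul_one] at h1; exact sub_eq_zero.mp h1
  have h4 : x * e = e * x * e := by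
    rw [sub_mul, sub_mul, one_mul] at h2; exact sub_eq_zero.mp h2
  exact h3.trans h4.symm

theorem stmt5 (p : ℕ) (hp : p.Prime) (R : Type u) [Ring R]
    (hpJ : (p : R) ∈ Ideal.jacobson (⊥ : Ideal R))
    (G : Type v) [Group G]
    (horder : ∀ g : G, ∃ n : ℕ, orderOf g = p ^ n)
    (hlf : ∀ H : Subgroup G, H.FG → Finite H) :
    UniquelyWeaklyNilCleanRing (MonoidAlgebra R G) ↔ UniquelyWeaklyNilCleanRing R := by
  let ι : R →+* MonoidAlgebra R G := MonoidAlgebra.singleOneRingHom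
  have hι : ∀ r, augm R G (ι r) = r := fun r => augm_single 1 r
  have hinj : Function.Injective ι := fun a b h => by rw [← hι a, ← hι b, h]
  constructor
  · intro hRG a
    refine ⟨?_, ?_⟩
    · obtain ⟨⟨w, e, hw, he, h⟩, -⟩ := hRG (ι a)
      exact ⟨augm R G w, augm R G e, hw.map _, VI_map _ he, by rw [← map_add, ← h, hι]⟩
    · intro w₁ e₁ w₂ e₂ hw₁ he₁ hw₂ he₂ h₁ h₂
      apply hinj
      rw [map_pow, map_pow]
      exact (hRG (ι a)).2 (ι w₁) _ (ι w₂) _ (hw₁.map _) (VI_map _ he₁) (hw₂.map _) (VI_map _ he₂)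
        (by rw [← map_add, ← h₁]) (by rw [← map_add, ← h₂])
  · intro hR
    have hpn := nilp_nat hR hpJ
    have hnil := augm_nil hp hpn horder hlf
    have hab := abel_of hR
    -- idempotents of RG lie in R
    have hidem : ∀ f : MonoidAlgebra R G, IsIdempotentElem f → f = ι (augm R G f) := by
      intro f hf
      have he : IsIdempotentElem (augm R G f) := hf.map _
      refine idem_nilp_eq_zero hf (he.map ι) ?_ ?_
      · exact (MonoidAlgebra.single_commute (fun m => Commute.one_left m) (hab _ he) f).symm
      · apply hnil; rw [map_sub, hι, sub_self]
    intro a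
    refine ⟨?_, ?_⟩
    · obtain ⟨⟨w, e, ⟨n, hn⟩, he, h⟩, -⟩ := hR (augm R G a)
      refine ⟨a - ι e, ι e, ?_, VI_map _ he, by abel⟩
      obtain ⟨m, hm⟩ := hnil ((a - ι e) ^ n) (by
        rw [map_pow, map_sub, hι, h, add_sub_cancel_right, hn])
      exact ⟨n * m, by rw [pow_mul, hm]⟩
    · intro w₁ e₁ w₂ e₂ hw₁ he₁ hw₂ he₂ h₁ h₂
      rw [hidem _ (sq_idem he₁), hidem _ (sq_idem he₂), map_pow (augm R G), map_pow (augm R G),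
        (hR (augm R G a)).2 _ _ _ _ (hw₁.map (augm R G)) (VI_map (augm R G) he₁)
          (hw₂.map (augm R G)) (VI_map (augm R G) he₂)
          (by rw [← map_add, ← h₁]) (by rw [← map_add, ← h₂])]
end

section
/- Let R be a ring (associative with identity, not necessarily commutative). Then R is uniquely weakly D-nil-clean if and only if R is a D-ring, or the following three conditions hold: (1) R is abelian; (2) R is periodic; and (3) R/J(R) is isomorphic (as a ring) to one of the following: a field F, ℤ/3ℤ × ℤ/3ℤ, ℤ/3ℤ × B where B is a Boolean ring, or a Boolean ring. -/
universe u v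

theorem pow_idem {R : Type u} [Ring R] (hp : PeriodicRing R) (a : R) :
    ∃ k : ℕ, 0 < k ∧ IsIdempotentElem (a ^ k) := by
  have key : ∀ m n : ℕ, 0 < m → m < n → a ^ m = a ^ n →
      ∃ k : ℕ, 0 < k ∧ IsIdempotentElem (a ^ k) := by
    intro m n hm hmn h
    obtain ⟨p, rfl⟩ := Nat.exists_eq_add_of_lt hmn
    have h1 : ∀ i, a ^ (m + i) = a ^ (m + i + (p + 1)) := by
      intro i
      have : m + i + (p + 1) = (m + p + 1) + i := by ring
      rw [this, pow_add, h, ← pow_add]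
    have h2 : ∀ j i, a ^ (m + i) = a ^ (m + i + j * (p + 1)) := by
      intro j
      induction j with
      | zero => intro i; simp
      | succ j ih =>
        intro i
        rw [ih i, add_assoc, h1]
        congr 1; ring
    refine ⟨m * (p + 1), by positivity, ?_⟩
    unfold IsIdempotentElem
    rw [← pow_add]
    have h3 := h2 m (m * p)
    have h4 : m + m * p = m * (p + 1) := by ring
    rw [h4] at h3
    exact h3.symm
  obtain ⟨m, n, hm, hn, hne, h⟩ := hp a
  rcases lt_or_gt_of_ne hne with hlt | hlt
  · exact key m n hm hlt h
  · exact key n m hn hlt h.symm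

theorem idem_jac {R : Type u} [Ring R] (e : R) (he : IsIdempotentElem e)
    (h : e ∈ Ideal.jacobson (⊥ : Ideal R)) : e = 0 := by
  obtain ⟨z, hz⟩ := Ideal.mem_jacobson_iff.1 h (-1)
  have hz' : z * -1 * e + z - 1 = 0 := by simpa using hz
  have h1 : (z * -1 * e + z - 1) * e = 0 := by rw [hz', zero_mul]
  have he' : e * e = e := he
  have h2 : (z * -1 * e + z - 1) * e = -e := by
    simp only [sub_mul, add_mul, mul_assoc, he', mul_neg, neg_mul, one_mul]
    abel
  rw [h2] at h1
  simpa using h1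

theorem jac_nil {R : Type u} [Ring R] (hp : PeriodicRing R) (a : R)
    (h : a ∈ Ideal.jacobson (⊥ : Ideal R)) : IsNilpotent a := by
  obtain ⟨k, hk, hi⟩ := pow_idem hp a
  refine ⟨k, idem_jac _ hi ?_⟩
  obtain ⟨j, rfl⟩ := Nat.exists_eq_succ_of_ne_zero hk.ne'
  rw [Nat.succ_eq_add_one, pow_succ]
  exact Ideal.mul_mem_left _ _ h

theorem nil_zero {S : Type v} [Ring S]
    (hS : ∀ s : S, IsUnit s ∨ s * s = s ∨ s * s = -s) (s : S) (hs : IsNilpotent s) : s = 0 := by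
  rcases hS s with h | h | h
  · obtain ⟨n, hn⟩ := hs
    have := h.pow n
    rw [hn, isUnit_zero_iff] at this
    rw [← mul_one s, ← this, mul_zero]
  · have hu := hs.isUnit_sub_one
    have h0 : s * (s - 1) = 0 := by rw [mul_sub, h]; simp
    exact hu.mul_left_eq_zero.1 h0
  · have hu := hs.isUnit_add_one
    have h0 : s * (s + 1) = 0 := by rw [mul_add, h]; simp
    exact hu.mul_left_eq_zero.1 h0

theorem very_sq {R : Type u} [Ring R] {e : R} (h : IsVeryIdempotent e) :
    e * e = e ∨ e * e = -e := by
  rcases h with h | h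
  · exact Or.inl h
  · right
    have h' : -e * -e = -e := h
    rw [neg_mul_neg] at h'; exact h'

theorem very_central {R : Type u} [Ring R] (ha : AbelianRing R) {e : R}
    (h : IsVeryIdempotent e) (x : R) : e * x = x * e := by
  rcases h with h | h
  · exact ha e h x
  · have := ha _ h x
    simpa using this

theorem back {R : Type u} [Ring R] {S : Type v} [Ring S]
    (ha : AbelianRing R) (hp : PeriodicRing R) (hq : QuotJacobsonIsoTo R S)
    (hS : ∀ s : S, IsUnit s ∨ s * s = s ∨ s * s = -s) (a : R) (hz : IsZeroDivisorPair a) :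
    IsUniquelyWeaklyNilClean a := by
  obtain ⟨f, hf, hk⟩ := hq
  have hnil : ∀ x, f x = 0 → IsNilpotent x := fun x hx => jac_nil hp x ((hk x).1 hx)
  obtain ⟨k, hkpos, hi⟩ := pow_idem hp a
  obtain ⟨j, rfl⟩ := Nat.exists_eq_succ_of_ne_zero hkpos.ne'
  constructor
  · have hsq : f a * f a = f a ∨ f a * f a = -f a := by
      rcases hS (f a) with h | h
      · exfalso
        have h1 : f (1 - a ^ j.succ) = 0 := by
          have hu := h.pow j.succ
          have h2 : f a ^ j.succ * (1 - f a ^ j.succ) = 0 := by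
            rw [← map_pow, mul_sub, ← map_mul, hi, mul_one, sub_self]
          rw [map_sub, map_one, map_pow]
          exact (hu.mul_right_eq_zero).1 h2
        have h3 := idem_jac _ hi.one_sub ((hk _).1 h1)
        obtain ⟨b, c, hb, hc, hab, hca⟩ := hz
        apply hb
        have h4 : a ^ j.succ * b = 0 := by
          rw [Nat.succ_eq_add_one, pow_succ, mul_assoc, hab, mul_zero]
        rw [← sub_eq_zero.1 h3, one_mul] at h4
        exact h4
      · exact h
    have hpow : ∀ n, f a ^ (2 * (n + 1)) = f a * f a := by
      intro n
      have h4 : (f a * f a) * (f a * f a) = f a * f a := by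
        rcases hsq with h | h
        · rw [h, h]
        · rw [h]; simp [h]
      rw [pow_mul, sq]
      exact IsIdempotentElem.pow_succ_eq n h4
    have hfe : f (a ^ j.succ) = f a * f a := by
      have h5 : a ^ j.succ = a ^ (2 * (j + 1)) := by
        rw [two_mul, pow_add]; exact hi.symm
      rw [h5, map_pow, hpow]
    rcases hsq with h | h
    · refine ⟨a - a ^ j.succ, a ^ j.succ, hnil _ ?_, Or.inl hi, by abel⟩
      rw [map_sub, hfe, h, sub_self]
    · refine ⟨a + a ^ j.succ, -a ^ j.succ, hnil _ ?_, Or.inr (by rwa [neg_neg]), by abel⟩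
      rw [map_add, hfe, h]; abel
  · intro w₁ e₁ w₂ e₂ hw₁ he₁ hw₂ he₂ h₁ h₂
    have hfn : ∀ w, IsNilpotent w → f w = 0 := fun w hw => nil_zero hS _ (hw.map f)
    have hfe : f e₁ = f e₂ := by
      have := congrArg f (h₁.symm.trans h₂)
      rwa [map_add, map_add, hfn _ hw₁, hfn _ hw₂, zero_add, zero_add] at this
    have hid : ∀ e : R, IsVeryIdempotent e → (e * e) * (e * e) = e * e := by
      intro e he
      rcases very_sq he with h | h
      · rw [h, h]
      · rw [h]; simp [h]
    rw [sq, sq]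
    have c1 := hid _ he₁
    have c2 := hid _ he₂
    have hc : (e₁ * e₁) * (e₂ * e₂) = (e₂ * e₂) * (e₁ * e₁) := ha _ c1 _
    have hf0 : f (e₁ * e₁) = f (e₂ * e₂) := by rw [map_mul, map_mul, hfe]
    generalize e₁ * e₁ = p at *
    generalize e₂ * e₂ = q at *
    have key : ∀ p q : R, p * p = p → q * q = q → p * q = q * p → f p = f q → p * (1 - q) = 0 := by
      intro p q hp hq hc hf
      apply idem_jac
      · unfold IsIdempotentElem
        have : (p * (1 - q)) * (p * (1 - q)) = (p * p) * (1 - q) - p * (q * p) * (1 - q) := by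
          noncomm_ring
        rw [this, hp, ← hc, ← mul_assoc p p q, hp, mul_assoc p q, mul_sub q, hq]
        simp
      · rw [← hk, map_mul, map_sub, map_one, hf, mul_sub, ← map_mul, hq]; simp
    have k1 := key p q c1 c2 hc hf0
    have k2 := key q p c2 c1 hc.symm hf0.symm
    rw [mul_sub, mul_one, sub_eq_zero] at k1 k2
    rw [k1, hc, ← k2]

theorem dring_back {R : Type u} [Ring R]
    (hd : ∀ a : R, IsZeroDivisorPair a → IsNilpotent a) (a : R) (hz : IsZeroDivisorPair a) :
    IsUniquelyWeaklyNilClean a := by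
  have hn := hd a hz
  refine ⟨⟨a, 0, hn, Or.inl IsIdempotentElem.zero, by simp⟩, ?_⟩
  have key : ∀ w e : R, IsNilpotent w → IsVeryIdempotent e → a = w + e → e ^ 2 = 0 := by
    intro w e hw he h
    have main : ∀ g : R, IsIdempotentElem g → g = 0 ∨ g = 1 := by
      intro g hg
      by_contra hcon
      push Not at hcon
      have h1 : (1 : R) - g ≠ 0 := fun h => hcon.2 (sub_eq_zero.1 h).symm
      have hg' : g * g = g := hg
      obtain ⟨n, hn⟩ := hd g ⟨1 - g, 1 - g, h1, h1, by rw [mul_sub, hg']; simp,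
        by rw [sub_mul, hg']; simp⟩
      have : g ^ (n + 1) = g := hg.pow_succ_eq n
      rw [pow_succ, hn, zero_mul] at this
      exact hcon.1 this.symm
    have triv : IsUnit a → e ^ 2 = 0 := by
      intro hu
      obtain ⟨n, hn⟩ := hn
      have := hu.pow n
      rw [hn, isUnit_zero_iff] at this
      rw [← mul_one (e ^ 2), ← this, mul_zero]
    rcases he with he | he
    · rcases main e he with h0 | h0
      · rw [h0]; simp
      · apply triv; rw [h, h0]; exact hw.isUnit_add_one
    · rcases main _ he with h0 | h0
      · rw [neg_eq_zero] at h0; rw [h0]; simp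
      · apply triv
        have : e = -1 := by rw [← h0, neg_neg]
        rw [h, this, ← sub_eq_add_neg]; exact hw.isUnit_sub_one
  intro w₁ e₁ w₂ e₂ hw₁ he₁ hw₂ he₂ h₁ h₂
  rw [key _ _ hw₁ he₁ h₁, key _ _ hw₂ he₂ h₂]

theorem monic_cube (A : Type*) [CommRing A] (n : ℕ) :
    ((Polynomial.X ^ 3 - Polynomial.X : Polynomial A) ^ n).Monic := by
  apply Polynomial.Monic.pow
  apply Polynomial.monic_X_pow_sub
  exact lt_of_le_of_lt Polynomial.degree_X_le (by norm_num)

theorem periodic_of_alg (A : Type*) [CommRing A] [Finite A] {R : Type u} [Ring R] [Algebra A R]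
    (h : ∀ x : R, IsNilpotent (x ^ 3 - x)) : PeriodicRing R := by
  intro a
  have hint : IsIntegral A a := by
    obtain ⟨n, hn⟩ := h a
    refine ⟨(Polynomial.X ^ 3 - Polynomial.X) ^ n, monic_cube A n, ?_⟩
    rw [← Polynomial.aeval_def]; simp [hn]
  have := Algebra.finite_adjoin_simple_of_isIntegral hint
  have : Finite (Algebra.adjoin A {a}) := Module.finite_of_finite A
  let b : Algebra.adjoin A {a} := ⟨a, Algebra.subset_adjoin rfl⟩
  obtain ⟨m, n, hne, hmn⟩ := Finite.exists_ne_map_eq_of_infinite (fun n : ℕ => b ^ (n + 1))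
  refine ⟨m + 1, n + 1, by omega, by omega, by omega, ?_⟩
  have := congrArg Subtype.val hmn
  simpa [b] using this

theorem periodic_of_cube {R : Type u} [Ring R] (h : ∀ x : R, IsNilpotent (x ^ 3 - x)) :
    PeriodicRing R := by
  have hc : ringChar R ≠ 0 := by
    intro h0
    obtain ⟨n, hn⟩ := h 2
    have h6 : ((6 ^ n : ℕ) : R) = 0 := by
      push_cast; rw [← hn]; norm_num
    have := ringChar.dvd h6
    rw [h0, zero_dvd_iff] at this
    exact absurd this (by positivity)
  haveI : NeZero (ringChar R) := ⟨hc⟩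
  letI : Algebra (ZMod (ringChar R)) R := ZMod.algebra R (ringChar R)
  exact periodic_of_alg (ZMod (ringChar R)) h

/-- If `g` is an idempotent of a commutative ring with `g S = {0, g, -g}` of characteristic 3,
then projection on `g S` is a surjection onto `ZMod 3`. -/
theorem proj3 {S : Type u} [CommRing S] (g : S) (hg : g * g = g) (hg0 : g ≠ 0) (h3 : 3 * g = 0)
    (h : ∀ x : S, g * x = 0 ∨ g * x = g ∨ g * x = -g) :
    ∃ f : S →+* ZMod 3, ∀ x, f x = 0 ↔ g * x = 0 := by
  let I : Ideal S := Ideal.span {1 - g}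
  have hI : ∀ x, Ideal.Quotient.mk I x = 0 ↔ g * x = 0 := by
    intro x
    rw [Ideal.Quotient.eq_zero_iff_mem, Ideal.mem_span_singleton]
    constructor
    · rintro ⟨c, rfl⟩
      linear_combination (-c) * hg
    · intro hx
      exact ⟨x, by linear_combination hx⟩
  haveI : Nontrivial (S ⧸ I) := by
    refine ⟨⟨1, 0, ?_⟩⟩
    rw [← map_one (Ideal.Quotient.mk I), Ne, hI, mul_one]; exact hg0
  have hq3 : ((3 : ℕ) : S ⧸ I) = 0 := by
    have : ((3 : ℕ) : S ⧸ I) = Ideal.Quotient.mk I 3 := rfl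
    rw [this, hI, mul_comm]; exact h3
  haveI : CharP (S ⧸ I) 3 := by
    obtain ⟨p, hp⟩ := CharP.exists (S ⧸ I)
    have hd := (CharP.cast_eq_zero_iff (S ⧸ I) p 3).1 hq3
    rcases (Nat.dvd_prime Nat.prime_three).1 hd with h1 | h1
    · exact absurd h1 (CharP.char_ne_one (S ⧸ I) p)
    · rwa [h1] at hp
  let φ := ZMod.castHom (dvd_refl 3) (S ⧸ I)
  have hinj : Function.Injective φ := ZMod.castHom_injective _
  have hsurj : Function.Surjective φ := by
    intro y
    obtain ⟨x, rfl⟩ := Ideal.Quotient.mk_surjective y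
    rcases h x with h | h | h
    · exact ⟨0, by rw [map_zero]; exact ((hI x).2 h).symm⟩
    · refine ⟨1, ?_⟩
      rw [map_one, ← sub_eq_zero, ← map_one (Ideal.Quotient.mk I), ← map_sub, hI]
      linear_combination -h
    · refine ⟨-1, ?_⟩
      rw [map_neg, map_one, ← sub_eq_zero, ← map_one (Ideal.Quotient.mk I), ← map_neg,
        ← map_sub, hI]
      linear_combination -h
  let ψ := RingEquiv.ofBijective φ ⟨hinj, hsurj⟩
  refine ⟨ψ.symm.toRingHom.comp (Ideal.Quotient.mk I), ?_⟩
  intro x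
  rw [← hI]
  simp

theorem zmod3_surj {S : Type u} [Ring S] (f : S →+* ZMod 3) (a : ZMod 3) : ∃ x : S, f x = a := by
  refine ⟨(a.val : S), ?_⟩
  rw [map_natCast]; simp

theorem dichotomy {S : Type u} [CommRing S]
    (h3 : ∀ x : S, x ^ 3 = x)
    (h2 : ∀ g : S, g * g = g → g ≠ 0 → g ≠ 1 → ∀ x : S,
      (g * x) * (g * x) = g * x ∨ (g * x) * (g * x) = -(g * x))
    (g : S) (hg : g * g = g) (hg0 : g ≠ 0) (hg1 : g ≠ 1) (hg3 : 3 * g = 0) (x : S) :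
    g * x = 0 ∨ g * x = g ∨ g * x = -g := by
  have hh : g * x * x = 0 ∨ g * x * x = g := by
    have hx := h3 x
    rcases h2 g hg hg0 hg1 (2 * (x * x) - 1) with h | h
    · right
      linear_combination (x ^ 2 - 1) * hg3 + h - (2 * x ^ 2 - 1) ^ 2 * hg - 4 * g * x * hx
    · left
      linear_combination x ^ 2 * hg3 - h + (2 * x ^ 2 - 1) ^ 2 * hg + 4 * g * x * hx
  have := h2 g hg hg0 hg1 x
  have e : g * x * (g * x) = g * x * x := by linear_combination (x * x) * hg
  rw [e] at this
  rcases hh with h | h <;> rw [h] at this <;> rcases this with t | t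
  · left; exact t.symm
  · left; linear_combination t
  · right; left; exact t.symm
  · right; right; linear_combination t

theorem classify {S : Type u} [CommRing S]
    (h3 : ∀ x : S, x ^ 3 = x)
    (h2 : ∀ g : S, g * g = g → g ≠ 0 → g ≠ 1 → ∀ x : S,
      (g * x) * (g * x) = g * x ∨ (g * x) * (g * x) = -(g * x))
    (e : S) (he : e * e = e) (he0 : e ≠ 0) (he1 : e ≠ 1) :
    (∃ f : S →+* ZMod 3 × ZMod 3, Function.Bijective f) ∨
    (∃ (B : Type u) (_ : Ring B), IsBooleanRing B ∧
      ∃ f : S →+* ZMod 3 × B, Function.Bijective f) ∨ IsBooleanRing S := by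
  have h6 : (6 : S) = 0 := by have := h3 2; linear_combination this
  by_cases c2 : (2 : S) = 0
  · right; right
    intro x
    show x * x = x
    have a := h3 (x + 1)
    have b := h3 x
    linear_combination a - b - (x * x + 2 * x) * c2 + (x * 0) * c2
  by_cases c3 : (3 : S) = 0
  · left
    have he' : (1 - e) * (1 - e) = 1 - e := by linear_combination he
    have he0' : 1 - e ≠ 0 := fun h => he1 (by linear_combination -h)
    have he1' : 1 - e ≠ 1 := fun h => he0 (by linear_combination -h)
    obtain ⟨f, hf⟩ := proj3 e he he0 (by rw [c3, zero_mul])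
      (dichotomy h3 h2 e he he0 he1 (by rw [c3, zero_mul]))
    obtain ⟨f', hf'⟩ := proj3 (1 - e) he' he0' (by rw [c3, zero_mul])
      (dichotomy h3 h2 (1 - e) he' he0' he1' (by rw [c3, zero_mul]))
    refine ⟨f.prod f', ?_, ?_⟩
    · rw [injective_iff_map_eq_zero]
      intro x hx
      have hx1 := (hf x).1 (congrArg Prod.fst hx)
      have hx2 := (hf' x).1 (congrArg Prod.snd hx)
      linear_combination hx1 + hx2
    · rintro ⟨a, b⟩
      obtain ⟨x, rfl⟩ := zmod3_surj f a
      obtain ⟨y, rfl⟩ := zmod3_surj f' b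
      refine ⟨e * x + (1 - e) * y, Prod.ext ?_ ?_⟩
      · show f _ = f x
        rw [← sub_eq_zero, ← map_sub, hf]
        linear_combination (x - y) * he
      · show f' _ = f' y
        rw [← sub_eq_zero, ← map_sub, hf']
        linear_combination (y - x) * he
  · right; left
    have hg : (4 : S) * 4 = 4 := by linear_combination 2 * h6
    have hg0 : (4 : S) ≠ 0 := fun h => c2 (by linear_combination h6 - h)
    have hg1 : (4 : S) ≠ 1 := fun h => c3 (by linear_combination h)
    have hg3 : (3 : S) * 4 = 0 := by linear_combination 2 * h6
    obtain ⟨f, hf⟩ := proj3 4 hg hg0 hg3 (dichotomy h3 h2 4 hg hg0 hg1 hg3)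
    let I : Ideal S := Ideal.span {2}
    have hI : ∀ x, Ideal.Quotient.mk I x = 0 ↔ 3 * x = 0 := by
      intro x
      rw [Ideal.Quotient.eq_zero_iff_mem, Ideal.mem_span_singleton]
      constructor
      · rintro ⟨c, rfl⟩
        linear_combination c * h6
      · intro hx
        exact ⟨-x, by linear_combination hx⟩
    refine ⟨S ⧸ I, inferInstance, ?_, f.prod (Ideal.Quotient.mk I), ?_, ?_⟩
    · intro y
      obtain ⟨x, rfl⟩ := Ideal.Quotient.mk_surjective y
      show _ * _ = _
      rw [← map_mul, ← sub_eq_zero, ← map_sub, hI]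
      have a := h3 (x + 1)
      have b := h3 x
      linear_combination a - b - x * h6
    · rw [injective_iff_map_eq_zero]
      intro x hx
      have hx1 := (hf x).1 (congrArg Prod.fst hx)
      have hx2 := (hI x).1 (congrArg Prod.snd hx)
      linear_combination hx1 - hx2
    · rintro ⟨a, b⟩
      obtain ⟨x, rfl⟩ := zmod3_surj f a
      obtain ⟨y, rfl⟩ := Ideal.Quotient.mk_surjective b
      refine ⟨4 * x + 3 * y, Prod.ext ?_ ?_⟩
      · show f _ = f x
        rw [← sub_eq_zero, ← map_sub, hf]
        linear_combination (2 * x + 2 * y) * h6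
      · show Ideal.Quotient.mk I _ = Ideal.Quotient.mk I y
        rw [← sub_eq_zero, ← map_sub, hI]
        linear_combination (2 * x + y) * h6

theorem forward {R : Type u} [Ring R]
    (H : ∀ a : R, IsZeroDivisorPair a → IsUniquelyWeaklyNilClean a)
    (hnd : ¬ ∀ a : R, IsZeroDivisorPair a → IsNilpotent a) :
    AbelianRing R ∧ PeriodicRing R ∧
           (QuotJacobsonIsoTo R (ZMod 3 × ZMod 3) ∨
           (∃ (B : Type u) (_ : Ring B), IsBooleanRing B ∧ QuotJacobsonIsoTo R (ZMod 3 × B)) ∨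
           (∃ (B : Type u) (_ : Ring B), IsBooleanRing B ∧ QuotJacobsonIsoTo R B)) := by
  have zd : ∀ e : R, IsIdempotentElem e → e ≠ 1 → IsZeroDivisorPair e := by
    intro e he h1
    have h1 : (1 : R) - e ≠ 0 := fun h => h1 (sub_eq_zero.1 h).symm
    have he' : e * e = e := he
    exact ⟨1 - e, 1 - e, h1, h1, by rw [mul_sub, he']; simp, by rw [sub_mul, he']; simp⟩
  have hab : AbelianRing R := by
    intro e he x
    by_cases h1 : e = 1
    · rw [h1]; simp
    have he' : e * e = e := he
    have key : ∀ n : R, n * n = 0 → e * n + n * e = n → n = 0 := by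
      intro n hn hen
      have hid : IsIdempotentElem (e + n) := by
        show (e + n) * (e + n) = e + n
        have : (e + n) * (e + n) = e * e + (e * n + n * e) + n * n := by noncomm_ring
        rw [this, he', hen, hn, add_zero]
      have := (H e (zd e he h1)).2 0 e (-n) (e + n) IsNilpotent.zero (Or.inl he)
        (IsNilpotent.neg ⟨2, by rw [sq, hn]⟩) (Or.inl hid) (by simp) (by abel)
      rw [sq, sq, he', hid] at this
      simpa using this
    have k1 := key (e * x * (1 - e))
      (by
        have : e * x * (1 - e) * (e * x * (1 - e)) = e * x * (e - e * e) * (x * (1 - e)) := by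
          noncomm_ring
        rw [this, he']; simp)
      (by
        have : e * (e * x * (1 - e)) + e * x * (1 - e) * e
          = (e * e) * x * (1 - e) + e * x * (e - e * e) := by noncomm_ring
        rw [this, he']; simp)
    have k2 := key ((1 - e) * x * e)
      (by
        have : (1 - e) * x * e * ((1 - e) * x * e) = (1 - e) * x * (e - e * e) * (x * e) := by
          noncomm_ring
        rw [this, he']; simp)
      (by
        have : e * ((1 - e) * x * e) + (1 - e) * x * e * e
          = (e - e * e) * x * e + (1 - e) * x * (e * e) := by noncomm_ring
        rw [this, he']; simp)
    rw [mul_sub, mul_one, sub_eq_zero] at k1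
    rw [sub_mul, sub_mul, one_mul, sub_eq_zero] at k2
    rw [k1, k2]
  have dec : ∀ e : R, IsIdempotentElem e → e ≠ 1 → ∀ x : R, ∃ w v : R, IsNilpotent w ∧
      IsVeryIdempotent v ∧ e * x = w + v := by
    intro e he h1 x
    have h1 : (1 : R) - e ≠ 0 := fun h => h1 (sub_eq_zero.1 h).symm
    have he' : e * e = e := he
    exact (H (e * x) ⟨1 - e, 1 - e, h1, h1,
      by rw [hab e he x, mul_assoc, mul_sub, he']; simp,
      by rw [← mul_assoc, sub_mul, he']; simp⟩).1
  obtain ⟨e, he, he0, he1⟩ : ∃ e : R, IsIdempotentElem e ∧ e ≠ 0 ∧ e ≠ 1 := by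
    push Not at hnd
    obtain ⟨a, hz, hn⟩ := hnd
    obtain ⟨⟨w, e, hw, he, h⟩, -⟩ := H a hz
    have nu : ¬ IsUnit a := by
      intro hu
      obtain ⟨b, c, hb, hc, hab, hca⟩ := hz
      exact hb (hu.mul_right_eq_zero.1 hab)
    rcases he with he | he
    · refine ⟨e, he, ?_, ?_⟩
      · rintro rfl; apply hn; rw [h, add_zero]; exact hw
      · rintro rfl; apply nu; rw [h]; exact hw.isUnit_add_one
    · refine ⟨-e, he, ?_, ?_⟩
      · intro h0; rw [neg_eq_zero] at h0; apply hn; rw [h, h0, add_zero]; exact hw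
      · intro h0; apply nu
        have : e = -1 := by rw [← h0, neg_neg]
        rw [h, this, ← sub_eq_add_neg]; exact hw.isUnit_sub_one
  have he' : e * e = e := he
  have he1' : 1 - e ≠ 1 := fun h => he0 (by simpa using h)
  have cubeE : ∀ g : R, IsIdempotentElem g → g ≠ 1 → ∀ x, IsNilpotent ((g * x) ^ 3 - g * x) := by
    intro g hg h1 x
    obtain ⟨w, v, hw, hv, h⟩ := dec g hg h1 x
    have hc := very_central hab hv w
    have hv3 : v * v * v = v := by
      rcases very_sq hv with h | h
      · rw [h, h]
      · rw [h]; simp [h]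
    rw [h]
    have : (w + v) ^ 3 - (w + v) = w * (w * w + 3 * (w * v) + 3 * (v * v) - 1) := by
      have e1 : (w + v) ^ 3 = w * w * w + (w * w * v + w * (v * w) + v * w * w) +
        (w * v * v + v * w * v + v * (v * w)) + v * v * v := by noncomm_ring
      rw [e1, hv3, hc]
      rw [← mul_assoc v w v, hc, mul_assoc w v w, hc]
      noncomm_ring
    rw [this]
    have cw : Commute w v := hc.symm
    refine Commute.isNilpotent_mul_right ?_ hw
    have c3 : Commute w (3 : R) := Commute.ofNat_right w 3
    exact ((((Commute.refl w).mul_right (Commute.refl w)).add_right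
      (c3.mul_right ((Commute.refl w).mul_right cw))).add_right
      (c3.mul_right (cw.mul_right cw))).sub_right (Commute.one_right w)
  have cube : ∀ x : R, IsNilpotent (x ^ 3 - x) := by
    intro x
    have n1 := cubeE e he he1 x
    have n2 := cubeE (1 - e) he.one_sub he1' x
    have cx : Commute e x := hab e he x
    have cx' : Commute (1 - e) x := hab _ he.one_sub x
    have p1 : (e * x) ^ 3 - e * x = e * (x ^ 3 - x) := by
      rw [cx.mul_pow, he.pow_succ_eq 2, mul_sub]
    have p2 : ((1 - e) * x) ^ 3 - (1 - e) * x = (1 - e) * (x ^ 3 - x) := by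
      rw [cx'.mul_pow, he.one_sub.pow_succ_eq 2, mul_sub]
    rw [p1] at n1
    rw [p2] at n2
    have : x ^ 3 - x = e * (x ^ 3 - x) + (1 - e) * (x ^ 3 - x) := by noncomm_ring
    rw [this]
    refine Commute.isNilpotent_add ?_ n1 n2
    have ce : ∀ y, Commute e y := fun y => hab e he y
    have ce' : ∀ y, Commute (1 - e) y := fun y => hab _ he.one_sub y
    exact (ce _).mul_left ((ce' _).symm.mul_right (Commute.refl _))
  have hper := periodic_of_cube cube
  have nilJ : ∀ a : R, IsNilpotent a → a ∈ Ideal.jacobson (⊥ : Ideal R) := by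
    intro a ha
    have hra : ∀ r : R, IsNilpotent (r * a) := by
      intro r
      obtain ⟨k, hk, hi⟩ := pow_idem hper (r * a)
      obtain ⟨j, rfl⟩ := Nat.exists_eq_succ_of_ne_zero hk.ne'
      refine ⟨j.succ, ?_⟩
      have hs : (r * a) ^ j.succ = ((r * a) ^ j * r) * a := by
        rw [Nat.succ_eq_add_one, pow_succ, mul_assoc]
      generalize (r * a) ^ j.succ = g at *
      generalize (r * a) ^ j * r = s at *
      have ind : ∀ n, g = g * (s ^ n * a ^ n) := by
        intro n
        induction n with
        | zero => simp
        | succ n ih =>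
          have hgg : g * g = g := hi
          calc g = g * g := hgg.symm
            _ = g * (g * (s ^ n * a ^ n)) := by rw [← ih]
            _ = g * (s ^ n * g * a ^ n) := by rw [← mul_assoc g (s ^ n), hab g hi (s ^ n)]
            _ = g * (s ^ n * (s * a) * a ^ n) := by rw [← hs]
            _ = g * (s ^ (n + 1) * a ^ (n + 1)) := by
              rw [pow_succ s, pow_succ' a]; simp only [mul_assoc]
      obtain ⟨n, hn⟩ := ha
      rw [ind n, hn]; simp
    rw [Ideal.mem_jacobson_iff]
    intro y
    obtain ⟨u, hu⟩ := (hra y).isUnit_add_one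
    refine ⟨↑u⁻¹, ?_⟩
    have : (↑u⁻¹ : R) * y * a + ↑u⁻¹ - 1 = 0 := by
      have : (↑u⁻¹ : R) * y * a + ↑u⁻¹ = ↑u⁻¹ * (y * a + 1) := by noncomm_ring
      rw [this, ← hu]; simp
    rw [this]; simp
  refine ⟨hab, hper, ?_⟩
  let J : Ideal R := Ideal.jacobson ⊥
  let f : R →+* R ⧸ J := Ideal.Quotient.mk J
  have hfs : Function.Surjective f := Ideal.Quotient.mk_surjective
  have hf : ∀ a, f a = 0 ↔ a ∈ Ideal.jacobson (⊥ : Ideal R) :=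
    fun a => Ideal.Quotient.eq_zero_iff_mem
  have hcomm : ∀ x y : R ⧸ J, x * y = y * x := by
    intro x y
    obtain ⟨x, rfl⟩ := hfs x
    obtain ⟨y, rfl⟩ := hfs y
    obtain ⟨w, v, hw, hv, h⟩ := dec e he he1 x
    obtain ⟨w', v', hw', hv', h'⟩ := dec (1 - e) he.one_sub he1' x
    have hx : x = e * x + (1 - e) * x := by noncomm_ring
    have hfx : f x = f (v + v') := by
      rw [hx, h, h', map_add, map_add, map_add, (hf w).2 (nilJ w hw), (hf w').2 (nilJ w' hw')]
      simp
    rw [hfx, ← map_mul, ← map_mul, add_mul, mul_add, very_central hab hv, very_central hab hv']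
  letI : CommRing (R ⧸ J) := { (inferInstance : Ring (R ⧸ J)) with mul_comm := hcomm }
  have tr : ∀ {T : Type u} [Ring T] (φ : (R ⧸ J) →+* T), Function.Bijective φ →
      QuotJacobsonIsoTo R T := by
    intro T _ φ hφ
    refine ⟨φ.comp f, hφ.2.comp hfs, fun a => ?_⟩
    rw [← hf, RingHom.comp_apply, map_eq_zero_iff φ hφ.1]
  have tr0 : ∀ (φ : (R ⧸ J) →+* ZMod 3 × ZMod 3), Function.Bijective φ →
      QuotJacobsonIsoTo R (ZMod 3 × ZMod 3) := by
    intro φ hφ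
    refine ⟨φ.comp f, hφ.2.comp hfs, fun a => ?_⟩
    rw [← hf, RingHom.comp_apply, map_eq_zero_iff φ hφ.1]
  have main := classify (S := R ⧸ J) ?_ ?_ (f e) ?_ ?_ ?_
  · rcases main with ⟨φ, hφ⟩ | ⟨B, iB, hB, φ, hφ⟩ | hB
    · exact Or.inl (tr0 φ hφ)
    · exact Or.inr (Or.inl ⟨B, iB, hB, tr φ hφ⟩)
    · exact Or.inr (Or.inr ⟨R ⧸ J, inferInstance, hB, f, hfs, hf⟩)
  · intro x
    obtain ⟨x, rfl⟩ := hfs x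
    rw [← sub_eq_zero]
    have := (hf _).2 (nilJ _ (cube x))
    rwa [map_sub, map_pow] at this
  · intro g hg hg0 hg1 x
    obtain ⟨x, rfl⟩ := hfs x
    obtain ⟨b, rfl⟩ := hfs g
    obtain ⟨k, hk, hi⟩ := pow_idem hper b
    obtain ⟨j, rfl⟩ := Nat.exists_eq_succ_of_ne_zero hk.ne'
    have hb : f (b ^ j.succ) = f b := by
      rw [map_pow]; exact IsIdempotentElem.pow_succ_eq j hg
    rw [← hb] at hg1 ⊢
    have hne : b ^ j.succ ≠ 1 := by
      intro h; apply hg1; rw [h, map_one]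
    obtain ⟨w, v, hw, hv, h⟩ := dec _ hi hne x
    have hfv : f (b ^ j.succ) * f x = f v := by
      rw [← map_mul, h, map_add, (hf w).2 (nilJ w hw), zero_add]
    rw [hfv, ← map_mul, ← map_neg]
    rcases very_sq hv with h | h
    · left; rw [h]
    · right; rw [h]
  · rw [← map_mul, he']
  · intro h
    exact he0 (idem_jac e he ((hf e).1 h))
  · intro h
    apply he1
    have : f (1 - e) = 0 := by rw [map_sub, map_one, h, sub_self]
    exact (sub_eq_zero.1 (idem_jac _ he.one_sub ((hf _).1 this))).symm

theorem stmt9 (R : Type u) [Ring R] :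
    (∀ a : R, IsZeroDivisorPair a → IsUniquelyWeaklyNilClean a) ↔
      ((∀ a : R, IsZeroDivisorPair a → IsNilpotent a) ∨
        (AbelianRing R ∧ PeriodicRing R ∧
          ((∃ (F : Type u) (_ : Field F), QuotJacobsonIsoTo R F) ∨
           QuotJacobsonIsoTo R (ZMod 3 × ZMod 3) ∨
           (∃ (B : Type u) (_ : Ring B), IsBooleanRing B ∧ QuotJacobsonIsoTo R (ZMod 3 × B)) ∨
           (∃ (B : Type u) (_ : Ring B), IsBooleanRing B ∧ QuotJacobsonIsoTo R B)))) := by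
  constructor
  · intro H
    by_cases hnd : ∀ a : R, IsZeroDivisorPair a → IsNilpotent a
    · exact Or.inl hnd
    · obtain ⟨h1, h2, h3⟩ := forward H hnd
      exact Or.inr ⟨h1, h2, Or.inr h3⟩
  · have hbool : ∀ (B : Type u) [Ring B], IsBooleanRing B → ∀ b : B, -b = b := by
      intro B _ hB b
      have h1 : (-b) * (-b) = -b := hB (-b)
      have h2 : b * b = b := hB b
      rw [neg_mul_neg, h2] at h1
      exact h1.symm
    rintro (hd | ⟨h1, h2, ⟨F, iF, h⟩ | h | ⟨B, iB, hB, h⟩ | ⟨B, iB, hB, h⟩⟩)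
    · exact dring_back hd
    · refine back h1 h2 h fun s => ?_
      by_cases hs : s = 0
      · right; left; rw [hs]; simp
      · left; exact isUnit_iff_ne_zero.2 hs
    · refine back h1 h2 h fun s => ?_
      have : ∀ s : ZMod 3 × ZMod 3, s * s = 1 ∨ s * s = s ∨ s * s = -s := by decide
      rcases this s with h | h
      · left; exact IsUnit.of_mul_eq_one s h
      · right; exact h
    · refine back h1 h2 h fun s => ?_
      obtain ⟨x, b⟩ := s
      right
      have hx : ∀ x : ZMod 3, x * x = x ∨ x * x = -x := by decide
      have hb : b * b = b := hB b
      rcases hx x with h | h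
      · left; exact Prod.ext h hb
      · right; exact Prod.ext h (hb.trans (hbool B hB b).symm)
    · refine back h1 h2 h fun s => Or.inr (Or.inl (hB s))
end
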